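/- arXiv:1103.0317 — 2 statements merged into one kernel-verified Lean document; each statement's English description precedes it below -/
import Mathlib

section
/- Let 1 ≤ s ≤ t ≤ n be integers with s dividing n. Then the number of (s,t,n)-LRM realizable sequences satisfies |R(s,t,n)| ≤ (t-s)! · (t!/(t-s)!)^(n/s). -/
/-- The window "rank" of cell `i` in the window of size `t` starting at position `p`
(indices taken modulo `n`): the number of cells in the window whose value is smaller. -/
noncomputable def windowCount (n t : ℕ) (c : ZMod n → ℝ) (p : ℕ) (i : Fin t) : ℕ :=
  (Finset.univ.filter fun j : Fin t =>
    c (((p + (j : ℕ) : ℕ) : ZMod n)) < c (((p + (i : ℕ) : ℕ) : ZMod n))).card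

/-- A sequence of `n/s` permutations of `Fin t` is `(s,t,n)`-LRM realizable if some injective
`c : ZMod n → ℝ` demodulates to it, i.e. the `k`-th permutation is the one induced by the
window of size `t` at position `k·s`. -/
def LRMRealizable (s t n : ℕ) (f : Fin (n / s) → Equiv.Perm (Fin t)) : Prop :=
  ∃ c : ZMod n → ℝ, Function.Injective c ∧
    ∀ (k : Fin (n / s)) (i : Fin t), ((f k i : ℕ)) = windowCount n t c ((k : ℕ) * s) i

theorem windowCount_lt_iff (n t : ℕ) (c : ZMod n → ℝ) (p : ℕ) (i j : Fin t) :
    windowCount n t c p i < windowCount n t c p j ↔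
      c (((p + (i : ℕ) : ℕ) : ZMod n)) < c (((p + (j : ℕ) : ℕ) : ZMod n)) := by
  unfold windowCount
  constructor
  · intro h
    by_contra hc
    have hc := not_lt.mp hc
    refine absurd h (not_lt.mpr (Finset.card_le_card ?_))
    intro x hx
    simp only [Finset.mem_filter, Finset.mem_univ, true_and] at hx ⊢
    exact lt_of_lt_of_le hx hc
  · intro h
    apply Finset.card_lt_card
    rw [Finset.ssubset_iff_of_subset]
    · exact ⟨i, by simpa using h, by simp⟩
    · intro x hx
      simp only [Finset.mem_filter, Finset.mem_univ, true_and] at hx ⊢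
      exact hx.trans h

/-- A permutation is determined by its values on a tail and the relative order of the head. -/
theorem perm_eq_of_tail (t r : ℕ) (σ τ : Equiv.Perm (Fin t))
    (h1 : ∀ i : Fin t, r ≤ (i : ℕ) → σ i = τ i)
    (h2 : ∀ i j : Fin t, (i : ℕ) < r → (j : ℕ) < r → (σ i < σ j ↔ τ i < τ j)) : σ = τ := by
  have key : ∀ (N : ℕ) (v : Fin t), (v : ℕ) = N → σ.symm v = τ.symm v := by
    intro N
    induction N using Nat.strong_induction_on with
    | _ N ih =>
      intro v hv
      by_contra hne
      have hi : (σ.symm v : ℕ) < r := by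
        by_contra hc
        have := h1 (σ.symm v) (not_lt.mp hc)
        apply hne
        rw [Equiv.apply_symm_apply] at this
        rw [Equiv.eq_symm_apply, ← this]
      have hj : (τ.symm v : ℕ) < r := by
        by_contra hc
        have := h1 (τ.symm v) (not_lt.mp hc)
        apply hne
        rw [Equiv.apply_symm_apply] at this
        rw [Equiv.symm_apply_eq, this]
      have h := h2 _ _ hj hi
      rw [Equiv.apply_symm_apply, Equiv.apply_symm_apply] at h
      have hA : ¬ σ (τ.symm v) < v := by
        intro hlt
        have := ih _ (by rw [← hv]; exact hlt) (σ (τ.symm v)) rfl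
        rw [Equiv.symm_apply_apply] at this
        have h3 := τ.symm.injective this
        rw [← h3] at hlt
        exact lt_irrefl _ hlt
      have hB : ¬ τ (σ.symm v) < v := by
        intro hlt
        have := ih _ (by rw [← hv]; exact hlt) (τ (σ.symm v)) rfl
        rw [Equiv.symm_apply_apply] at this
        have h3 := σ.symm.injective this
        rw [h3] at hlt
        exact lt_irrefl _ hlt
      have h4 : v = τ (σ.symm v) := le_antisymm (not_lt.mp hB) (not_lt.mp (fun hh => hA (h.mpr hh)))
      apply hne
      rw [Equiv.eq_symm_apply, ← h4]
  apply Equiv.symm_bijective.injective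
  ext v
  rw [key _ v rfl]

theorem card_compat (s t M : ℕ) (hst : s ≤ t) (S : Set (Fin (M + 1) → Equiv.Perm (Fin t)))
    (hS : ∀ f ∈ S, ∀ (k : Fin M) (i j : Fin t) (hi : (i : ℕ) + s < t) (hj : (j : ℕ) + s < t),
      (f k.succ i < f k.succ j ↔ f k.castSucc ⟨i + s, hi⟩ < f k.castSucc ⟨j + s, hj⟩)) :
    S.ncard ≤ t.factorial * (t.descFactorial s) ^ M := by
  let e : Fin s ↪ Fin t :=
    ⟨fun x => ⟨t - s + x, by omega⟩, fun x y h => by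
      simp only [Fin.mk.injEq] at h; ext; omega⟩
  let F : (Fin (M + 1) → Equiv.Perm (Fin t)) → Equiv.Perm (Fin t) × (Fin M → (Fin s ↪ Fin t)) :=
    fun f => (f 0, fun k => e.trans (f k.succ).toEmbedding)
  have hF : Set.InjOn F S := by
    intro f hf g hg h
    simp only [F, Prod.mk.injEq] at h
    obtain ⟨h0, h1⟩ := h
    funext k
    induction k using Fin.induction with
    | zero => exact h0
    | succ k ih =>
      apply perm_eq_of_tail t (t - s)
      · intro i hi
        have := congrFun h1 k
        have := DFunLike.congr_fun this ⟨i - (t - s), by omega⟩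
        have he : e ⟨i - (t - s), by omega⟩ = i := by
          apply Fin.ext
          change t - s + (i - (t - s)) = (i : ℕ)
          omega
        simpa [he] using this
      · intro i j hi hj
        rw [hS f hf k i j (by omega) (by omega), hS g hg k i j (by omega) (by omega), ih]
  have := Set.ncard_le_ncard_of_injOn (t := Set.univ) F (fun _ _ => Set.mem_univ _) hF
  rw [Set.ncard_univ, Nat.card_eq_fintype_card] at this
  simpa [Fintype.card_perm, Fintype.card_embedding_eq] using this

/-- For `1 ≤ s ≤ t ≤ n` with `s ∣ n`,
`|R(s,t,n)| ≤ (t-s)! · (t!/(t-s)!)^(n/s)`. -/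
theorem lrm_card_upper_bound (s t n : ℕ) (hs : 1 ≤ s) (hst : s ≤ t) (htn : t ≤ n)
    (hdvd : s ∣ n) :
    Set.ncard {f : Fin (n / s) → Equiv.Perm (Fin t) | LRMRealizable s t n f} ≤
      (t - s).factorial * (t.factorial / (t - s).factorial) ^ (n / s) := by
  unfold LRMRealizable
  have hpos : 0 < n / s := Nat.div_pos (hst.trans htn) hs
  obtain ⟨M, hM⟩ : ∃ M, n / s = M + 1 := ⟨n / s - 1, by omega⟩
  rw [hM]
  rw [← Nat.descFactorial_eq_div hst, pow_succ', ← mul_assoc, Nat.factorial_mul_descFactorial hst]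
  apply card_compat s t M hst
  rintro f ⟨c, -, hc⟩ k i j hi hj
  rw [Fin.lt_def, Fin.lt_def, hc, hc, hc, hc, windowCount_lt_iff, windowCount_lt_iff]
  have e : ∀ x : ℕ, (k.succ : ℕ) * s + x = (k.castSucc : ℕ) * s + (x + s) := by
    intro x; simp only [Fin.val_succ, Fin.val_castSucc]; ring
  rw [e, e]
end

section
/- Let 1 ≤ s ≤ t ≤ n with s dividing n, and let c : ℤ/nℤ → ℝ be injective. Then adjacent window permutations of the demodulated sequence agree on their overlap: for every position p and all i, j ∈ {0,…,t−s−1}, f_{c,p,t}(s+i) < f_{c,p,t}(s+j) if and only if f_{c,p+s,t}(i) < f_{c,p+s,t}(j). -/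
/-- For `1 ≤ s ≤ t ≤ n` with `s ∣ n` and injective `c : ZMod n → ℝ`,
adjacent window permutations agree on their overlap: for every position `p` and all
`i, j ∈ {0,…,t-s-1}`, `f_{c,p,t}(s+i) < f_{c,p,t}(s+j) ↔ f_{c,p+s,t}(i) < f_{c,p+s,t}(j)`. -/
theorem adjacent_windows_agree_on_overlap (s t n : ℕ) (hs : 1 ≤ s) (hst : s ≤ t)
    (htn : t ≤ n) (hdvd : s ∣ n) (c : ZMod n → ℝ) (hc : Function.Injective c)
    (p : ℕ) (i j : Fin (t - s)) :
    windowCount n t c p ⟨s + (i : ℕ), by have := i.isLt; omega⟩ <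
        windowCount n t c p ⟨s + (j : ℕ), by have := j.isLt; omega⟩ ↔
      windowCount n t c (p + s) ⟨(i : ℕ), by have := i.isLt; omega⟩ <
        windowCount n t c (p + s) ⟨(j : ℕ), by have := j.isLt; omega⟩ := by
  rw [windowCount_lt_iff, windowCount_lt_iff]
  simp only [Nat.add_assoc]
end
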